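/- arXiv:2001.06359 — 2 statements merged into one kernel-verified Lean document; each statement's English description precedes it below -/
import Mathlib

section
/- Let k be an algebraically closed field. Then the group GL_2(k) has exactly three z-classes. -/
/-- Two elements of a group are *z-equivalent* if their centralizers are conjugate:
there is `a` with `a ⬝ Z(g) ⬝ a⁻¹ = Z(h)`. -/
def IsZEquiv {G : Type*} [Group G] (g h : G) : Prop :=
  ∃ a : G, ∀ x : G, x ∈ Subgroup.centralizer {g} ↔ a * x * a⁻¹ ∈ Subgroup.centralizer {h}

namespace IsZEquiv

variable {G : Type*} [Group G] {g h l : G}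

theorem refl (g : G) : IsZEquiv g g := ⟨1, by simp⟩

theorem symm : IsZEquiv g h → IsZEquiv h g := by
  rintro ⟨a, ha⟩
  refine ⟨a⁻¹, fun x => ?_⟩
  rw [ha]
  group

theorem trans : IsZEquiv g h → IsZEquiv h l → IsZEquiv g l := by
  rintro ⟨a, ha⟩ ⟨b, hb⟩
  refine ⟨b * a, fun x => ?_⟩
  rw [ha, hb]
  simp only [mul_inv_rev, mul_assoc]

theorem of_centralizer_eq
    (H : Subgroup.centralizer {g} = Subgroup.centralizer {h}) : IsZEquiv g h :=
  ⟨1, by simp [H]⟩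

theorem of_mul_eq_mul {p : G} (H : g * p = p * h) : IsZEquiv g h := by
  refine ⟨p⁻¹, fun x => ?_⟩
  obtain rfl : g = p * h * p⁻¹ := eq_mul_inv_of_mul_eq H
  simp only [Subgroup.mem_centralizer_singleton_iff]
  constructor <;> intro hx
  · calc _ = p⁻¹ * ((p * h * p⁻¹) * x) * p := by rw [← hx]; group
      _ = _ := by group
  · calc _ = p * ((p⁻¹ * x * p⁻¹⁻¹) * h) * p⁻¹ := by group
      _ = p * (h * (p⁻¹ * x * p⁻¹⁻¹)) * p⁻¹ := by rw [hx]
      _ = _ := by group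

theorem mem_center (H : IsZEquiv 1 h) : h ∈ Subgroup.center G := by
  obtain ⟨a, ha⟩ := H
  refine Subgroup.mem_center_iff.2 fun x => ?_
  have := (ha (a⁻¹ * x * a)).1 (by simp [Subgroup.mem_centralizer_singleton_iff])
  simpa [Subgroup.mem_centralizer_singleton_iff, mul_assoc] using this

theorem setOf_eq_iff : {x | IsZEquiv g x} = {x | IsZEquiv h x} ↔ IsZEquiv g h := by
  refine ⟨fun H => ?_, fun H => Set.ext fun x => ⟨H.symm.trans, H.trans⟩⟩
  have : h ∈ {x | IsZEquiv h x} := refl h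
  rwa [← H] at this

end IsZEquiv

namespace Matrix.GeneralLinearGroup

variable {k : Type*} [Field k]

theorem mem_centralizer_singleton_fin_two_iff (g x : GL (Fin 2) k) :
    x ∈ Subgroup.centralizer {g} ↔
      (x 0 0 * g 0 0 + x 0 1 * g 1 0 = g 0 0 * x 0 0 + g 0 1 * x 1 0 ∧
        x 0 0 * g 0 1 + x 0 1 * g 1 1 = g 0 0 * x 0 1 + g 0 1 * x 1 1) ∧
      (x 1 0 * g 0 0 + x 1 1 * g 1 0 = g 1 0 * x 0 0 + g 1 1 * x 1 0 ∧
        x 1 0 * g 0 1 + x 1 1 * g 1 1 = g 1 0 * x 0 1 + g 1 1 * x 1 1) := by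
  rw [Subgroup.mem_centralizer_singleton_iff, Units.ext_iff, ← Matrix.ext_iff]
  simp [Fin.forall_fin_two, Matrix.mul_apply]

theorem mul_eq_mul_fin_two {g p t : GL (Fin 2) k}
    (h₀₀ : g 0 0 * p 0 0 + g 0 1 * p 1 0 = p 0 0 * t 0 0 + p 0 1 * t 1 0)
    (h₀₁ : g 0 0 * p 0 1 + g 0 1 * p 1 1 = p 0 0 * t 0 1 + p 0 1 * t 1 1)
    (h₁₀ : g 1 0 * p 0 0 + g 1 1 * p 1 0 = p 1 0 * t 0 0 + p 1 1 * t 1 0)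
    (h₁₁ : g 1 0 * p 0 1 + g 1 1 * p 1 1 = p 1 0 * t 0 1 + p 1 1 * t 1 1) :
    g * p = p * t := by
  rw [Units.ext_iff, ← Matrix.ext_iff]
  simp [Fin.forall_fin_two, Matrix.mul_apply, *]

theorem det_fin_two_ne_zero (g : GL (Fin 2) k) : g 0 0 * g 1 1 - g 0 1 * g 1 0 ≠ 0 := by
  rw [← Matrix.det_fin_two]
  exact g.det_ne_zero

/-- Over an algebraically closed field every invertible `2 × 2` matrix can be triangularized. -/
theorem exists_isZEquiv_upperTriangular [IsAlgClosed k] (g : GL (Fin 2) k) :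
    ∃ t : GL (Fin 2) k, t 1 0 = 0 ∧ IsZEquiv g t := by
  by_cases hr : g 1 0 = 0
  · exact ⟨g, hr, .refl g⟩
  obtain ⟨c, hc⟩ := IsAlgClosed.exists_root (g : Matrix (Fin 2) (Fin 2) k).charpoly
    (by simp [Matrix.charpoly_degree_eq_dim])
  have hc' : c ^ 2 - (g 0 0 + g 1 1) * c + (g 0 0 * g 1 1 - g 0 1 * g 1 0) = 0 := by
    simpa [Matrix.charpoly_fin_two, Matrix.trace_fin_two, Matrix.det_fin_two] using hc
  have hg := det_fin_two_ne_zero g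
  refine ⟨mkOfDetNeZero !![c, 1; 0, g 0 0 + g 1 1 - c] ?_, by simp [mkOfDetNeZero],
    .of_mul_eq_mul (p := mkOfDetNeZero !![c - g 1 1, 1; g 1 0, 0] ?_)
      (mul_eq_mul_fin_two ?_ ?_ ?_ ?_)⟩
  · rw [Matrix.det_fin_two_of]
    exact fun h => hg (by linear_combination hc' + h)
  · simpa [Matrix.det_fin_two_of] using hr
  all_goals simp [mkOfDetNeZero]
  · linear_combination -hc'
  · ring

theorem isZEquiv_one_of_scalar {t : GL (Fin 2) k} (h₁₀ : t 1 0 = 0) (h₀₁ : t 0 1 = 0)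
    (h : t 0 0 = t 1 1) : IsZEquiv 1 t := by
  refine .of_centralizer_eq (Subgroup.ext fun x => ?_)
  simp only [mem_centralizer_singleton_fin_two_iff, h₁₀, h₀₁, h]
  simp [mul_comm]

/-- All non-semisimple upper triangular elements of `GL 2 k` have the same centralizer. -/
theorem isZEquiv_of_nonsemisimple {s t : GL (Fin 2) k}
    (hs₁₀ : s 1 0 = 0) (hs₀₁ : s 0 1 ≠ 0) (hs : s 0 0 = s 1 1)
    (ht₁₀ : t 1 0 = 0) (ht₀₁ : t 0 1 ≠ 0) (ht : t 0 0 = t 1 1) : IsZEquiv s t := by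
  have key {s : GL (Fin 2) k} (hs₁₀ : s 1 0 = 0) (hs₀₁ : s 0 1 ≠ 0) (hs : s 0 0 = s 1 1)
      (x : GL (Fin 2) k) : x ∈ Subgroup.centralizer {s} ↔ x 1 0 = 0 ∧ x 0 0 = x 1 1 := by
    simp only [mem_centralizer_singleton_fin_two_iff, hs₁₀, hs]
    constructor
    · rintro ⟨⟨h₁, h₂⟩, -⟩
      exact ⟨mul_left_cancel₀ hs₀₁ (by linear_combination -h₁),
        mul_left_cancel₀ hs₀₁ (by linear_combination h₂)⟩
    · rintro ⟨h₁, h₂⟩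
      simp [h₁, h₂, mul_comm, add_comm]
  exact .of_centralizer_eq (Subgroup.ext fun x => by rw [key hs₁₀ hs₀₁ hs, key ht₁₀ ht₀₁ ht])

theorem isZEquiv_of_diagonal {s t : GL (Fin 2) k}
    (hs₁₀ : s 1 0 = 0) (hs₀₁ : s 0 1 = 0) (hs : s 0 0 ≠ s 1 1)
    (ht₁₀ : t 1 0 = 0) (ht₀₁ : t 0 1 = 0) (ht : t 0 0 ≠ t 1 1) : IsZEquiv s t := by
  have key {s : GL (Fin 2) k} (hs₁₀ : s 1 0 = 0) (hs₀₁ : s 0 1 = 0) (hs : s 0 0 ≠ s 1 1)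
      (x : GL (Fin 2) k) : x ∈ Subgroup.centralizer {s} ↔ x 1 0 = 0 ∧ x 0 1 = 0 := by
    simp only [mem_centralizer_singleton_fin_two_iff, hs₁₀, hs₀₁]
    constructor
    · rintro ⟨⟨-, h₂⟩, h₃, -⟩
      exact ⟨mul_left_cancel₀ (sub_ne_zero.2 hs) (by linear_combination h₃),
        mul_left_cancel₀ (sub_ne_zero.2 hs) (by linear_combination -h₂)⟩
    · rintro ⟨h₁, h₂⟩
      simp [h₁, h₂, mul_comm]
  exact .of_centralizer_eq (Subgroup.ext fun x => by rw [key hs₁₀ hs₀₁ hs, key ht₁₀ ht₀₁ ht])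

theorem exists_isZEquiv_diagonal {t : GL (Fin 2) k} (h₁₀ : t 1 0 = 0) (h : t 0 0 ≠ t 1 1) :
    ∃ d : GL (Fin 2) k, d 1 0 = 0 ∧ d 0 1 = 0 ∧ d 0 0 ≠ d 1 1 ∧ IsZEquiv t d := by
  have ht := det_fin_two_ne_zero t
  refine ⟨mkOfDetNeZero !![t 0 0, 0; 0, t 1 1] ?_, by simp [mkOfDetNeZero],
    by simp [mkOfDetNeZero], by simpa [mkOfDetNeZero] using h,
    .of_mul_eq_mul (p := mkOfDetNeZero !![1, t 0 1; 0, t 1 1 - t 0 0] ?_)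
      (mul_eq_mul_fin_two ?_ ?_ ?_ ?_)⟩
  · simpa [Matrix.det_fin_two_of, h₁₀] using ht
  · simpa [Matrix.det_fin_two_of, sub_eq_zero] using h.symm
  all_goals simp [mkOfDetNeZero, h₁₀]
  · ring
  · ring

theorem not_isZEquiv_one {h : GL (Fin 2) k}
    (hh : h 0 1 ≠ 0 ∨ h 0 0 ≠ h 1 1) : ¬ IsZEquiv 1 h := by
  intro H
  have hx := Subgroup.mem_center_iff.1 H.mem_center
  have hmem (x : GL (Fin 2) k) := (mem_centralizer_singleton_fin_two_iff h x).1
    (Subgroup.mem_centralizer_singleton_iff.2 (hx x))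
  obtain ⟨⟨-, h₁⟩, -⟩ := hmem (mkOfDetNeZero !![1, 1; 0, 1] (by simp))
  obtain ⟨⟨h₂, -⟩, -⟩ := hmem (mkOfDetNeZero !![1, 0; 1, 1] (by simp))
  simp [mkOfDetNeZero] at h₁ h₂
  rw [add_comm, add_left_inj] at h₁
  exact hh.elim (· h₂) (· h₁.symm)

theorem not_isZEquiv_diagonal_nonsemisimple {d s : GL (Fin 2) k}
    (hd₁₀ : d 1 0 = 0) (hd : d 0 0 ≠ d 1 1)
    (hs₁₀ : s 1 0 = 0) (hs₀₁ : s 0 1 ≠ 0) (hs : s 0 0 = s 1 1) : ¬ IsZEquiv d s := by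
  rintro ⟨a, ha⟩
  have hmem := (ha d).1 (by simp [Subgroup.mem_centralizer_singleton_iff])
  set y := a * d * a⁻¹ with hy
  have htr : y 0 0 + y 1 1 = d 0 0 + d 1 1 := by
    rw [← Matrix.trace_fin_two, ← Matrix.trace_fin_two, hy]
    exact Matrix.trace_units_conj a d
  have hdet : y 0 0 * y 1 1 - y 0 1 * y 1 0 = d 0 0 * d 1 1 - d 0 1 * d 1 0 := by
    rw [← Matrix.det_fin_two, ← Matrix.det_fin_two, hy]
    exact Matrix.det_units_conj a d
  simp only [mem_centralizer_singleton_fin_two_iff, hs₁₀, hs] at hmem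
  obtain ⟨⟨h₁, h₂⟩, -⟩ := hmem
  have hy₁₀ : y 1 0 = 0 := mul_left_cancel₀ hs₀₁ (by linear_combination -h₁)
  have hy' : y 0 0 = y 1 1 := mul_left_cancel₀ hs₀₁ (by linear_combination h₂)
  rw [hy₁₀, hy', hd₁₀] at hdet
  rw [hy'] at htr
  refine hd (sub_eq_zero.1 (pow_eq_zero_iff two_ne_zero |>.1 ?_))
  linear_combination 4 * hdet - (2 * y 1 1 + d 0 0 + d 1 1) * htr

end Matrix.GeneralLinearGroup

open Matrix.GeneralLinearGroup in
/-- Over an algebraically closed field `k`, the group `GL 2 k` has exactly three z-classes. -/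
theorem three_zClasses_GL_two_of_isAlgClosed (k : Type*) [Field k] [IsAlgClosed k] :
    {C : Set (GL (Fin 2) k) |
      ∃ g : GL (Fin 2) k, C = {h : GL (Fin 2) k | IsZEquiv g h}}.ncard = 3 := by
  classical
  have : Infinite k := IsAlgClosed.instInfinite
  obtain ⟨c, hc⟩ := Infinite.exists_notMem_finset ({0, 1} : Finset k)
  simp only [Finset.mem_insert, Finset.mem_singleton, not_or] at hc
  obtain ⟨d, hd₁₀, hd₀₁, hd⟩ : ∃ d : GL (Fin 2) k, d 1 0 = 0 ∧ d 0 1 = 0 ∧ d 0 0 ≠ d 1 1 :=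
    ⟨mkOfDetNeZero !![c, 0; 0, 1] (by simpa using hc.1), by simpa [mkOfDetNeZero] using hc.2⟩
  obtain ⟨s, hs₁₀, hs₀₁, hs⟩ : ∃ s : GL (Fin 2) k, s 1 0 = 0 ∧ s 0 1 ≠ 0 ∧ s 0 0 = s 1 1 :=
    ⟨mkOfDetNeZero !![1, 1; 0, 1] (by simp), by simp [mkOfDetNeZero]⟩
  refine Set.ncard_eq_three.2 ⟨{h | IsZEquiv 1 h}, {h | IsZEquiv d h}, {h | IsZEquiv s h},
    ?_, ?_, ?_, Set.ext fun C => ⟨?_, ?_⟩⟩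
  · exact fun H => not_isZEquiv_one (.inr hd) (IsZEquiv.setOf_eq_iff.1 H)
  · exact fun H => not_isZEquiv_one (.inl hs₀₁) (IsZEquiv.setOf_eq_iff.1 H)
  · exact fun H =>
      not_isZEquiv_diagonal_nonsemisimple hd₁₀ hd hs₁₀ hs₀₁ hs (IsZEquiv.setOf_eq_iff.1 H)
  · rintro ⟨g, rfl⟩
    simp only [Set.mem_insert_iff, Set.mem_singleton_iff, IsZEquiv.setOf_eq_iff]
    obtain ⟨t, ht₁₀, hgt⟩ := exists_isZEquiv_upperTriangular g
    by_cases ht : t 0 0 = t 1 1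
    · by_cases ht₀₁ : t 0 1 = 0
      · exact .inl (hgt.trans (isZEquiv_one_of_scalar ht₁₀ ht₀₁ ht).symm)
      · exact .inr (.inr (hgt.trans (isZEquiv_of_nonsemisimple ht₁₀ ht₀₁ ht hs₁₀ hs₀₁ hs)))
    · obtain ⟨e, he₁₀, he₀₁, he, hte⟩ := exists_isZEquiv_diagonal ht₁₀ ht
      exact .inr (.inl (hgt.trans
        (hte.trans (isZEquiv_of_diagonal he₁₀ he₀₁ he hd₁₀ hd₀₁ hd))))
  · rintro (rfl | rfl | rfl)
    exacts [⟨1, rfl⟩, ⟨d, rfl⟩, ⟨s, rfl⟩]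
end

section
/- For every integer n ≥ 2, the group SL_n(ℚ) has infinitely many z-classes: there exists an infinite family of semisimple elements of SL_n(ℚ) (elements with squarefree minimal polynomial) that are pairwise not z-equivalent in SL_n(ℚ). -/
open Matrix Polynomial

/-- The matrix with nonzero block `!![0, q; 1, 0]` in the upper left corner; it generates
non-unitally the algebra `ℚ[√q]`. -/
def sqrtBlock (m : ℕ) (q : ℚ) : Matrix (Fin (m + 2)) (Fin (m + 2)) ℚ :=
  single 1 0 1 + single 0 1 q

theorem sqrtBlock_sq (m : ℕ) (q : ℚ) :
    sqrtBlock m q * sqrtBlock m q = single 0 0 q + single 1 1 q := by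
  simp [sqrtBlock, add_mul, mul_add, add_comm]

theorem sqrtBlock_cube (m : ℕ) (q : ℚ) :
    sqrtBlock m q * sqrtBlock m q * sqrtBlock m q = q • sqrtBlock m q := by
  rw [sqrtBlock_sq]
  simp [sqrtBlock, add_mul, mul_add, smul_single, add_comm]

theorem sqrtBlock_ne_zero (m : ℕ) (q : ℚ) : sqrtBlock m q ≠ 0 := fun h ↦ by
  simpa [sqrtBlock] using congrFun (congrFun h 1) 0

/-- The norm-one element `(1 + √q) / (1 - √q)` of `ℚ(√q)`, as a product of transvections acting on
the first two coordinates. -/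
def normOneElement (m : ℕ) (q : ℚ) : SpecialLinearGroup (Fin (m + 2)) ℚ :=
  ⟨transvection 0 1 q * transvection 1 0 (2 / (1 - q)) * transvection 0 1 q, by
    simp [det_mul, det_transvection_of_ne]⟩

theorem coe_normOneElement (m : ℕ) {q : ℚ} (hq : q ≠ 1) :
    (normOneElement m q : Matrix (Fin (m + 2)) (Fin (m + 2)) ℚ) =
      1 + (2 / (1 - q)) • (sqrtBlock m q * sqrtBlock m q + sqrtBlock m q) := by
  have h : 1 - q ≠ 0 := sub_ne_zero.2 hq.symm
  have e : 2 / (1 - q) * q = q * (2 / (1 - q)) * q + (q + q) := by field_simp; ring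
  rw [sqrtBlock_sq, sqrtBlock]
  simp only [smul_add, smul_single, smul_eq_mul, mul_one]
  nth_rw 3 [e]
  simp [normOneElement, transvection, add_mul, mul_add, single_add, mul_comm q]
  abel

theorem commute_normOneElement_iff (m : ℕ) {q : ℚ} (hq : q ≠ 1)
    (x : Matrix (Fin (m + 2)) (Fin (m + 2)) ℚ) :
    Commute x (normOneElement m q : Matrix (Fin (m + 2)) (Fin (m + 2)) ℚ) ↔
      Commute x (sqrtBlock m q) := by
  rw [coe_normOneElement m hq]
  have h : 1 - q ≠ 0 := sub_ne_zero.2 hq.symm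
  set S := sqrtBlock m q
  have hS : S * S * S = q • S := sqrtBlock_cube m q
  constructor
  · intro hx
    have hE : Commute x (S * S + S) := by
      have := (hx.sub_right (Commute.one_right x)).smul_right ((1 - q) / 2)
      rwa [add_sub_cancel_left, smul_smul, div_mul_div_comm, mul_comm, div_self (by simpa),
        one_smul] at this
    have key : S = (1 - q)⁻¹ • ((q + 1) • (S * S + S) - (S * S + S) * (S * S + S)) := by
      have e : (S * S + S) * (S * S + S) = (q + 1) • (S * S) + (2 * q) • S := by
        have h4 : S * S * (S * S) = q • (S * S) := by rw [← mul_assoc, hS, smul_mul_assoc]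
        rw [add_mul, mul_add, mul_add, h4, hS, ← mul_assoc, hS]
        module
      rw [e, eq_inv_smul_iff₀ h]
      module
    rw [key]
    exact ((hE.smul_right _).sub_right (hE.mul_right hE)).smul_right _
  · intro hx
    exact (Commute.one_right x).add_right (((hx.mul_right hx).add_right hx).smul_right _)

theorem squarefree_minpoly_normOneElement (m : ℕ) {q : ℚ} (hq : q ≠ 1) (hq0 : q ≠ 0) :
    Squarefree (minpoly ℚ (normOneElement m q : Matrix (Fin (m + 2)) (Fin (m + 2)) ℚ)) := by
  have hX : (X ^ 3 - C q * X : ℚ[X]).Separable := by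
    have hC : (C q * C q⁻¹ : ℚ[X]) = 1 := by rw [← C_mul, mul_inv_cancel₀ hq0, C_1]
    have h2 : (C (1 / 2) * 2 : ℚ[X]) = 1 := by
      rw [show (2 : ℚ[X]) = C 2 from rfl, ← C_mul]; norm_num
    refine ⟨-9 * C q⁻¹ ^ 2 * C (1 / 2) * X, -C q⁻¹ + 3 * C q⁻¹ ^ 2 * C (1 / 2) * X ^ 2, ?_⟩
    simp only [derivative_sub, derivative_X_pow, derivative_mul, derivative_C, derivative_X]
    simp only [Nat.cast_ofNat, C_ofNat]
    linear_combination hC + 3 * C q⁻¹ * X ^ 2 * (2 * C (1 / 2) * hC + h2)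
  have hS : Module.End.IsSemisimple (toLinAlgEquiv' (sqrtBlock m q)) := by
    refine Module.End.isSemisimple_of_squarefree_aeval_eq_zero hX.squarefree ?_
    rw [← AlgEquiv.coe_toAlgHom, aeval_algHom_apply, map_sub, map_mul, map_pow, aeval_X, aeval_C,
      pow_succ, pow_two, sqrtBlock_cube, ← Algebra.smul_def, sub_self, map_zero]
  rw [← minpoly.algEquiv_eq toLinAlgEquiv', coe_normOneElement m hq]
  have := (hS.aeval (1 + (2 / (1 - q)) • (X * X + X))).minpoly_squarefree
  rw [← AlgEquiv.coe_toAlgHom, aeval_algHom_apply] at this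
  simpa using this

theorem not_isSquare_prime {p : ℕ} (hp : p.Prime) (x : ℚ) : x * x ≠ p := fun h ↦ by
  have : IsSquare (p : ℚ) := ⟨x, h.symm⟩
  exact hp.prime.not_isSquare (Rat.isSquare_natCast_iff.1 this)

theorem mul_sq_ne_of_primes {p q : ℕ} (hp : p.Prime) (hq : q.Prime) (hpq : p ≠ q) (y : ℚ) :
    q * (y * y) ≠ p := fun h ↦ by
  have : IsSquare ((p * q : ℕ) : ℚ) := ⟨q * y, by push_cast; rw [← h]; ring⟩
  obtain ⟨r, hr⟩ := Rat.isSquare_natCast_iff.1 this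
  have hs : Squarefree (p * q) :=
    Nat.squarefree_mul_iff.2 ⟨(Nat.coprime_primes hp hq).2 hpq, hp.prime.squarefree,
      hq.prime.squarefree⟩
  have hu := Nat.isUnit_iff.1 (hs r (hr ▸ dvd_rfl))
  subst hu
  exact hp.one_lt.ne' (Nat.eq_one_of_mul_eq_one_right hr)

theorem eq_zero_of_cube_of_commute {m p q : ℕ} (hp : p.Prime) (hq : q.Prime) (hpq : p ≠ q)
    {T : Matrix (Fin (m + 2)) (Fin (m + 2)) ℚ} (hT : T * T * T = (p : ℚ) • T)
    (hS : Commute T (sqrtBlock m q))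
    (hW : ∀ k l : Fin m, k ≠ l → Commute T (single k.succ.succ l.succ.succ 1)) : T = 0 := by
  have hq0 : (q : ℚ) ≠ 0 := by exact_mod_cast hq.ne_zero
  have hSe (a b) := congrFun (congrFun hS.eq a) b
  have hTe (a b) := congrFun (congrFun hT a) b
  simp only [sqrtBlock, mul_add, add_mul, Matrix.add_apply] at hSe
  have h11 : T 1 1 = T 0 0 := by simpa [single_mul_apply_same] using hSe 1 0
  have h01 : T 0 1 = q * T 1 0 := by simpa using hSe 0 0
  have n1 (k : Fin m) : k.succ.succ ≠ 1 := by simp [Fin.ext_iff]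
  have h0 (k : Fin m) : T 0 k.succ.succ = 0 := by
    simpa [mul_single_apply_of_ne, n1] using (hSe 1 k.succ.succ).symm
  have h1 (k : Fin m) : T 1 k.succ.succ = 0 := by
    simpa [mul_single_apply_of_ne, n1, hq0] using (hSe 0 k.succ.succ).symm
  have hk0 (k : Fin m) : T k.succ.succ 0 = 0 := by
    simpa [single_mul_apply_of_ne, n1, hq0] using hSe k.succ.succ 1
  have hk1 (k : Fin m) : T k.succ.succ 1 = 0 := by
    simpa [single_mul_apply_of_ne, n1] using hSe k.succ.succ 0
  have hkl (k l : Fin m) (h : k ≠ l) : T k.succ.succ l.succ.succ = 0 := by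
    simpa [h] using congrFun (congrFun (hW l k h.symm).eq k.succ.succ) k.succ.succ
  have hrow (k : Fin m) (M : Matrix (Fin (m + 2)) (Fin (m + 2)) ℚ) (j : Fin (m + 2)) :
      (M * T) j k.succ.succ = M j k.succ.succ * T k.succ.succ k.succ.succ := by
    rw [mul_apply, Fin.sum_univ_succ, Fin.sum_univ_succ,
      Fintype.sum_eq_single k fun l hl ↦ by rw [hkl l k hl, mul_zero]]
    simp [h0, h1]
  have hkk (k : Fin m) : T k.succ.succ k.succ.succ = 0 := by
    have e := hTe k.succ.succ k.succ.succ
    rw [hrow, hrow, Matrix.smul_apply, smul_eq_mul] at e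
    exact (mul_eq_mul_right_iff.1 e).resolve_left (not_isSquare_prime hp _)
  have e0 := hTe 0 0
  have e1 := hTe 1 0
  simp [mul_apply, Fin.sum_univ_succ, h0, h1, hk0, h11, h01] at e0 e1
  have h10 : T 1 0 = 0 := by
    by_contra hy
    have e2 : 3 * T 0 0 ^ 2 + q * (T 1 0 * T 1 0) = p :=
      mul_right_cancel₀ hy (by linear_combination e1)
    by_cases hx : T 0 0 = 0
    · exact mul_sq_ne_of_primes hp hq hpq (T 1 0) (by simpa [hx] using e2)
    · have e3 : T 0 0 ^ 2 + 3 * q * T 1 0 ^ 2 = p :=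
        mul_right_cancel₀ hx (by linear_combination e0)
      refine not_isSquare_prime hq (T 0 0 / T 1 0) ?_
      rw [div_mul_div_comm, div_eq_iff (mul_ne_zero hy hy)]
      linear_combination (e2 - e3) / 2
  have h00 : T 0 0 = 0 := by
    by_contra hx
    exact not_isSquare_prime hp (T 0 0) (mul_right_cancel₀ hx (by simpa [h10] using e0))
  ext i j
  refine Fin.cases ?_ (Fin.cases ?_ fun k ↦ ?_) i <;>
    refine Fin.cases ?_ (Fin.cases ?_ fun l ↦ ?_) j
  any_goals simp [h00, h01, h10, h11, h0, h1, hk0, hk1]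
  by_cases h : k = l
  · rw [h, hkk]
  · exact hkl k l h

theorem not_isZEquiv_normOneElement (m : ℕ) {p q : ℕ} (hp : p.Prime) (hq : q.Prime)
    (hpq : p ≠ q) : ¬ IsZEquiv (normOneElement m p) (normOneElement m q) := by
  rintro ⟨a, ha⟩
  have hp1 : (p : ℚ) ≠ 1 := by exact_mod_cast hp.one_lt.ne'
  have hq1 : (q : ℚ) ≠ 1 := by exact_mod_cast hq.one_lt.ne'
  let A : Matrix (Fin (m + 2)) (Fin (m + 2)) ℚ := a
  let A' : Matrix (Fin (m + 2)) (Fin (m + 2)) ℚ := (a⁻¹ : SpecialLinearGroup (Fin (m + 2)) ℚ)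
  have hA : A * A' = 1 := congrArg Subtype.val (mul_inv_cancel a)
  have hA' : A' * A = 1 := congrArg Subtype.val (inv_mul_cancel a)
  have hcomm (x : SpecialLinearGroup (Fin (m + 2)) ℚ)
      (hx : Commute (x : Matrix (Fin (m + 2)) (Fin (m + 2)) ℚ) (sqrtBlock m q)) :
      Commute (A * sqrtBlock m p * A') (x : Matrix (Fin (m + 2)) (Fin (m + 2)) ℚ) := by
    rw [← commute_normOneElement_iff m hq1] at hx
    have h1 := (ha (a⁻¹ * x * a)).2 (by
      rw [show a * (a⁻¹ * x * a) * a⁻¹ = x by group, Subgroup.mem_centralizer_singleton_iff]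
      exact Subtype.ext hx.eq)
    rw [Subgroup.mem_centralizer_singleton_iff] at h1
    have h2 : Commute (A' * x * A) (sqrtBlock m p) := by
      rw [← commute_normOneElement_iff m hp1]
      exact congrArg Subtype.val h1
    have h3 := congrArg (fun M ↦ A * M * A') h2.eq
    simp only [← mul_assoc, hA, one_mul] at h3
    simp only [mul_assoc, hA, mul_one] at h3
    rw [commute_iff_eq]
    simpa only [mul_assoc] using h3.symm
  have hT := eq_zero_of_cube_of_commute hp hq hpq (T := A * sqrtBlock m p * A') ?_ ?_ ?_
  · refine sqrtBlock_ne_zero m p ?_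
    calc sqrtBlock m p = A' * A * sqrtBlock m p * (A' * A) := by simp [hA']
      _ = A' * (A * sqrtBlock m p * A') * A := by simp only [mul_assoc]
      _ = 0 := by simp [hT]
  · calc _ = A * sqrtBlock m p * (A' * A) * sqrtBlock m p * (A' * A) * sqrtBlock m p * A' := by
          simp only [mul_assoc]
      _ = A * (sqrtBlock m p * sqrtBlock m p * sqrtBlock m p) * A' := by
          simp only [hA', mul_one, mul_assoc]
      _ = _ := by rw [sqrtBlock_cube]; simp
  · rw [← commute_normOneElement_iff m hq1]
    exact hcomm _ ((commute_normOneElement_iff m hq1 _).1 (Commute.refl _))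
  · intro k l hkl
    have h := hcomm ⟨transvection k.succ.succ l.succ.succ 1,
      det_transvection_of_ne _ _ (by simpa using hkl) _⟩ ?_
    · simpa [transvection] using h.sub_right (Commute.one_right _)
    · refine (Commute.one_left _).add_left ?_
      have n1 (i : Fin m) : i.succ.succ ≠ 1 := by simp [Fin.ext_iff]
      simp [commute_iff_eq, sqrtBlock, mul_add, add_mul, single_mul_single_of_ne, n1, (n1 _).symm,
        (Fin.succ_ne_zero _).symm]

/-- For every `n ≥ 2`, the group `SL n ℚ` has infinitely many z-classes: there is an
infinite (ℕ-indexed) family of semisimple elements (squarefree minimal polynomial)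
of `SL n ℚ` that are pairwise not z-equivalent. -/
theorem infinitely_many_zClasses_SL_rat (n : ℕ) (hn : 2 ≤ n) :
    ∃ g : ℕ → Matrix.SpecialLinearGroup (Fin n) ℚ,
      (∀ i, Squarefree (minpoly ℚ ((g i : Matrix (Fin n) (Fin n) ℚ)))) ∧
      (∀ i j, i ≠ j → ¬ IsZEquiv (g i) (g j)) := by
  obtain ⟨m, rfl⟩ := Nat.exists_eq_add_of_le' hn
  have hp := Nat.prime_nth_prime
  refine ⟨fun i ↦ normOneElement m (Nat.nth Nat.Prime i : ℕ), fun i ↦ ?_, fun i j hij ↦ ?_⟩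
  · exact squarefree_minpoly_normOneElement m (by exact_mod_cast (hp i).one_lt.ne')
      (by exact_mod_cast (hp i).ne_zero)
  · exact not_isZEquiv_normOneElement m (hp i) (hp j)
      fun h ↦ hij (Nat.nth_injective Nat.infinite_setOfPred_prime h)
end
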